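/- Let F be a finite field with q elements and let m₁, m₂ be integers with 0 ≤ m₁ ≤ m₂. Then the number of pairs (f₁, f₂), where fᵢ ∈ F[X,Y] is a homogeneous polynomial of degree mᵢ and f₁, f₂ are relatively prime, equals: (q−1)(q+1) if m₁ = m₂ = 0; (q−1)·q^{m₂+1} if m₁ = 0 and m₂ > 0; and (q−1)·q^{m₁+m₂−1}·(q²−1) if m₁ > 0. -/

import Mathlib

open MvPolynomial

/-- grading hom -/
noncomputable def gradHom (F : Type) [Field F] :
    MvPolynomial (Fin 2) F →ₐ[F] Polynomial (MvPolynomial (Fin 2) F) :=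
  aeval (fun i => Polynomial.C (X i) * Polynomial.X)

lemma gradHom_monomial {F : Type} [Field F] (d : Fin 2 →₀ ℕ) (r : F) :
    gradHom F (monomial d r) = Polynomial.monomial d.degree (monomial d r) := by
  rw [gradHom, aeval_monomial, ← Polynomial.C_mul_X_pow_eq_monomial]
  have h1 : (d.prod fun i k => (Polynomial.C (X i : MvPolynomial (Fin 2) F) * Polynomial.X) ^ k) =
      Polynomial.C (d.prod fun i k => (X i : MvPolynomial (Fin 2) F) ^ k) *
        Polynomial.X ^ d.degree := by
    simp only [mul_pow, Finsupp.prod_mul]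
    rw [Finsupp.degree_apply, Finsupp.prod, Finsupp.prod, Finsupp.prod, map_prod,
      Finset.prod_pow_eq_pow_sum]
    simp only [map_pow]
  have h2 : (algebraMap F (Polynomial (MvPolynomial (Fin 2) F))) r =
      Polynomial.C (C r) := rfl
  rw [h1, h2, monomial_eq, map_mul, mul_assoc]

lemma gradHom_hom {F : Type} [Field F] {f : MvPolynomial (Fin 2) F} {n : ℕ}
    (hf : f.IsHomogeneous n) : gradHom F f = Polynomial.monomial n f := by
  conv_lhs => rw [f.as_sum]
  conv_rhs => rw [f.as_sum]
  rw [map_sum, map_sum]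
  refine Finset.sum_congr rfl fun d hd => ?_
  rw [gradHom_monomial, hf.degree_eq_sum_deg_support hd]
  rfl

lemma gradHom_coeff {F : Type} [Field F] (f : MvPolynomial (Fin 2) F) (n : ℕ) :
    ((gradHom F f).coeff n).IsHomogeneous n := by
  rw [f.as_sum, map_sum, Polynomial.finsetSum_coeff]
  refine IsHomogeneous.sum _ _ _ fun d hd => ?_
  rw [gradHom_monomial, Polynomial.coeff_monomial]
  split_ifs with h
  · exact isHomogeneous_monomial _ h
  · exact isHomogeneous_zero _ _ _

lemma gradHom_eval {F : Type} [Field F] (f : MvPolynomial (Fin 2) F) :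
    (gradHom F f).eval 1 = f := by
  conv_lhs => rw [f.as_sum]
  conv_rhs => rw [f.as_sum]
  rw [map_sum, Polynomial.eval_finsetSum]
  refine Finset.sum_congr rfl fun d hd => ?_
  rw [gradHom_monomial]; simp

lemma hom_of_mul {F : Type} [Field F] {f g : MvPolynomial (Fin 2) F} {n : ℕ}
    (h : (f * g).IsHomogeneous n) (h0 : f * g ≠ 0) : ∃ k, f.IsHomogeneous k := by
  have h1 := gradHom_hom h
  rw [map_mul] at h1
  have hne : gradHom F f * gradHom F g ≠ 0 := by
    rw [h1]; simpa using h0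
  have hf := left_ne_zero_of_mul hne
  have hg := right_ne_zero_of_mul hne
  have e1 := Polynomial.natDegree_mul hf hg
  have e2 := Polynomial.natTrailingDegree_mul hf hg
  rw [h1, Polynomial.natDegree_monomial_eq _ h0] at e1
  rw [h1, Polynomial.natTrailingDegree_monomial h0] at e2
  have l1 := (gradHom F f).natTrailingDegree_le_natDegree
  have l2 := (gradHom F g).natTrailingDegree_le_natDegree
  refine ⟨(gradHom F f).natDegree, ?_⟩
  have key : gradHom F f = Polynomial.monomial (gradHom F f).natDegree
      ((gradHom F f).coeff (gradHom F f).natDegree) := by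
    ext1 k
    rw [Polynomial.coeff_monomial]
    split_ifs with hk
    · rw [hk]
    · rcases lt_or_gt_of_ne hk with hk | hk
      · exact Polynomial.coeff_eq_zero_of_natDegree_lt hk
      · exact Polynomial.coeff_eq_zero_of_lt_natTrailingDegree (by omega)
  have h2 := gradHom_eval f
  rw [key, Polynomial.eval_monomial, one_pow, mul_one] at h2
  have h3 := gradHom_coeff f (gradHom F f).natDegree
  rwa [h2] at h3

/-- hom_of_mul with degrees. -/
lemma hom_of_mul' {F : Type} [Field F] {f g : MvPolynomial (Fin 2) F} {n : ℕ}
    (h : (f * g).IsHomogeneous n) (h0 : f * g ≠ 0) :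
    ∃ k l, k + l = n ∧ f.IsHomogeneous k ∧ g.IsHomogeneous l := by
  obtain ⟨k, hk⟩ := hom_of_mul h h0
  obtain ⟨l, hl⟩ := hom_of_mul (f := g) (g := f) (by rwa [mul_comm]) (by rwa [mul_comm])
  exact ⟨k, l, (hk.mul hl).inj_right h h0, hk, hl⟩

/-- the exponent -/
noncomputable def expo (n i : ℕ) : Fin 2 →₀ ℕ := Finsupp.single 0 i + Finsupp.single 1 (n - i)

lemma expo_of_degree {n : ℕ} {d : Fin 2 →₀ ℕ} (h : d.degree = n) : d 0 ≤ n ∧ expo n (d 0) = d := by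
  have h' : d 0 + d 1 = n := by rw [← h, Finsupp.degree_eq_sum]; simp
  refine ⟨by omega, ?_⟩
  ext i
  fin_cases i
  · simp [expo]
  · simp [expo]; omega

/-- coefficient equivalence -/
noncomputable def homEquiv (F : Type) [Field F] (n : ℕ) :
    {f : MvPolynomial (Fin 2) F // f.IsHomogeneous n} ≃ (Fin (n + 1) → F) := by
  refine Equiv.ofBijective (fun f i => coeff (expo n i) f.1) ⟨?_, ?_⟩
  · rintro ⟨f, hf⟩ ⟨g, hg⟩ h
    ext d
    by_cases hd : d.degree = n
    · obtain ⟨h1, h2⟩ := expo_of_degree hd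
      have := congrFun h ⟨d 0, by omega⟩
      simpa [h2] using this
    · rw [hf.coeff_eq_zero hd, hg.coeff_eq_zero hd]
  · intro c
    refine ⟨⟨∑ i : Fin (n + 1), monomial (expo n i) (c i), ?_⟩, ?_⟩
    · refine IsHomogeneous.sum _ _ _ fun i _ => isHomogeneous_monomial _ ?_
      rw [expo, Finsupp.degree_eq_sum]; simp; omega
    · funext j
      simp only [coeff_sum, coeff_monomial]
      rw [Finset.sum_eq_single j]
      · simp
      · intro i _ hij
        rw [if_neg]
        intro h
        apply hij
        have := DFunLike.congr_fun h 0
        simp [expo] at this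
        exact Fin.ext this
      · simp

lemma finite_hom (F : Type) [Field F] [Fintype F] (n : ℕ) :
    {f : MvPolynomial (Fin 2) F | f.IsHomogeneous n}.Finite :=
  @Set.toFinite _ _ (Finite.of_equiv _ (homEquiv F n).symm)

lemma ncard_hom (F : Type) [Field F] [Fintype F] (n : ℕ) :
    {f : MvPolynomial (Fin 2) F | f.IsHomogeneous n}.ncard = Fintype.card F ^ (n + 1) := by
  rw [← Nat.card_coe_set_eq]
  refine (Nat.card_congr (homEquiv F n)).trans ?_
  simp

lemma ncard_hom' (F : Type) [Field F] [Fintype F] (n : ℕ) :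
    {f : MvPolynomial (Fin 2) F | f ≠ 0 ∧ f.IsHomogeneous n}.ncard =
      Fintype.card F ^ (n + 1) - 1 := by
  rw [← ncard_hom, ← Set.ncard_sdiff_singleton_of_mem (a := 0) (by exact isHomogeneous_zero _ _ _)]
  congr 1
  ext f
  simp [and_comm]

/-- coprime pairs with nonzero first member. -/
def coPairs (F : Type) [Field F] (a b : ℕ) : Set (MvPolynomial (Fin 2) F × MvPolynomial (Fin 2) F) :=
  {p | p.1 ≠ 0 ∧ p.1.IsHomogeneous a ∧ p.2.IsHomogeneous b ∧ IsRelPrime p.1 p.2}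

lemma isUnit_eq_C {F : Type} [Field F] {u : MvPolynomial (Fin 2) F} (hu : IsUnit u) :
    ∃ c : F, c ≠ 0 ∧ u = C c := by
  obtain ⟨h1, h2⟩ := MvPolynomial.isUnit_iff_totalDegree_of_isReduced.mp hu
  exact ⟨_, h1.ne_zero, totalDegree_eq_zero_iff_eq_C.mp h2⟩

lemma dvd_of_coprime {F : Type} [Field F] {d d' g h g' h' : MvPolynomial (Fin 2) F}
    (e1 : d * g = d' * g') (e2 : d * h = d' * h') (hc : IsRelPrime g h) : d' ∣ d := by
  let _ := UniqueFactorizationMonoid.toGCDMonoid (MvPolynomial (Fin 2) F)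
  have h1 : d' ∣ gcd (d * g) (d * h) := dvd_gcd ⟨_, e1⟩ ⟨_, e2⟩
  have h2 := h1.trans (gcd_mul_left' d g h).dvd
  exact (gcd_isUnit_iff_isRelPrime.mpr hc).dvd_mul_right.mp h2

/-- leading coefficient -/
noncomputable def lcf {F : Type} [Field F] (f : MvPolynomial (Fin 2) F) : F :=
  (MonomialOrder.lex (σ := Fin 2)).leadingCoeff f

lemma lcf_ne {F : Type} [Field F] {f : MvPolynomial (Fin 2) F} : lcf f ≠ 0 ↔ f ≠ 0 :=
  MonomialOrder.leadingCoeff_ne_zero_iff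

lemma lcf_mul_C {F : Type} [Field F] (f : MvPolynomial (Fin 2) F) (c : F) :
    lcf (f * C c) = lcf f * c := by
  simp [lcf, MonomialOrder.leadingCoeff_C]

/-- nonzero forms -/
def nzForms (F : Type) [Field F] (n : ℕ) : Set (MvPolynomial (Fin 2) F) :=
  {f | f ≠ 0 ∧ f.IsHomogeneous n}

/-- forms -/
def forms (F : Type) [Field F] (n : ℕ) : Set (MvPolynomial (Fin 2) F) :=
  {f | f.IsHomogeneous n}

/-- the multiplication map -/
noncomputable def mulMap (F : Type) [Field F] (a b : ℕ) (hab : a ≤ b) :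
    (Σ k : Fin (a + 1), nzForms F k × coPairs F (a - k) (b - k)) →
      {c : F // c ≠ 0} × nzForms F a × forms F b := fun x =>
  (⟨lcf x.2.1.1, lcf_ne.mpr x.2.1.2.1⟩,
    ⟨x.2.1.1 * x.2.2.1.1, mul_ne_zero x.2.1.2.1 x.2.2.2.1, by
      have := x.2.1.2.2.mul x.2.2.2.2.1
      rwa [Nat.add_sub_cancel' (by omega)] at this⟩,
    ⟨x.2.1.1 * x.2.2.1.2, by
      have := x.2.1.2.2.mul x.2.2.2.2.2.1
      rwa [Nat.add_sub_cancel' (by omega)] at this⟩)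

lemma mulMap_inj (F : Type) [Field F] (a b : ℕ) (hab : a ≤ b) :
    Function.Injective (mulMap F a b hab) := by
  rintro ⟨k, ⟨d, hd0, hd⟩, ⟨⟨g, h⟩, hg0, hg, hh, hc⟩⟩ ⟨k', ⟨d', hd0', hd'⟩, ⟨⟨g', h'⟩, hg0', hg', hh', hc'⟩⟩ H
  simp only [mulMap, Prod.mk.injEq, Subtype.mk.injEq] at H
  obtain ⟨H1, H2', H3'⟩ := H
  have H2 := congrArg Subtype.val H2'
  have H3 := congrArg Subtype.val H3'
  dsimp only at H2 H3
  dsimp only at hc hc'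
  have a1 : d' ∣ d := dvd_of_coprime H2 H3 hc
  have a2 : d ∣ d' := dvd_of_coprime H2.symm H3.symm hc'
  obtain ⟨u, hu⟩ := associated_of_dvd_dvd a1 a2
  obtain ⟨c, hc0, huc⟩ := isUnit_eq_C u.isUnit
  rw [huc] at hu
  have hdd : d = d' := by
    rw [← hu, lcf_mul_C] at H1
    have : c = 1 := by
      have := lcf_ne.mpr hd0'
      exact mul_left_cancel₀ this (by rw [H1, mul_one])
    rw [← hu, this]; simp
  subst hdd
  have hk : k = k' := Fin.ext (hd.inj_right hd' hd0)
  subst hk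
  have hgg := mul_left_cancel₀ hd0 H2
  have hhh := mul_left_cancel₀ hd0 H3
  subst hgg hhh
  rfl

lemma mulMap_surj (F : Type) [Field F] (a b : ℕ) (hab : a ≤ b) :
    Function.Surjective (mulMap F a b hab) := by
  rintro ⟨⟨c, hc⟩, ⟨f, hf0, hf⟩, ⟨f', hf'⟩⟩
  let _ := UniqueFactorizationMonoid.toGCDMonoid (MvPolynomial (Fin 2) F)
  obtain ⟨g, g', e, e', hu⟩ := extract_gcd f f'
  rw [gcd_isUnit_iff_isRelPrime] at hu
  generalize gcd f f' = d at e e'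
  have hd0 : d ≠ 0 := by rintro rfl; simp [hf0] at e
  have hl := lcf_ne.mpr hd0
  -- rescale
  obtain ⟨t, ht0, ht⟩ : ∃ t : F, t ≠ 0 ∧ lcf d * t = c :=
    ⟨c / lcf d, div_ne_zero hc hl, by field_simp⟩
  have hCt : (C t : MvPolynomial (Fin 2) F) * C t⁻¹ = 1 := by
    rw [← C_mul, mul_inv_cancel₀ ht0, C_1]
  have hU : IsUnit (C t⁻¹ : MvPolynomial (Fin 2) F) :=
    IsUnit.of_mul_eq_one (C t) (by rw [mul_comm]; exact hCt)
  have E : f = (d * C t) * (C t⁻¹ * g) := by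
    rw [mul_assoc, ← mul_assoc (C t), hCt, one_mul]; exact e
  have E' : f' = (d * C t) * (C t⁻¹ * g') := by
    rw [mul_assoc, ← mul_assoc (C t), hCt, one_mul]; exact e'
  have hR : IsRelPrime (C t⁻¹ * g) (C t⁻¹ * g') :=
    (isRelPrime_mul_unit_left hU).mpr hu
  have hlc : lcf (d * C t) = c := by rw [lcf_mul_C, ht]
  generalize d * C t = D at *
  generalize C t⁻¹ * g = G at *
  generalize C t⁻¹ * g' = G' at *
  subst E E'
  obtain ⟨k, l, hkl, hk, hG⟩ := hom_of_mul' hf hf0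
  have hD0 := left_ne_zero_of_mul hf0
  have hG' : G'.IsHomogeneous (b - k) := by
    by_cases h0 : G' = 0
    · rw [h0]; exact isHomogeneous_zero _ _ _
    · obtain ⟨k', l', hkl', hk', hl'⟩ := hom_of_mul' hf' (mul_ne_zero hD0 h0)
      have := hk.inj_right hk' hD0
      have : l' = b - k := by omega
      rwa [← this]
  have hl2 : l = a - k := by omega
  refine ⟨⟨⟨k, by omega⟩, ⟨D, hD0, hk⟩, ⟨⟨G, G'⟩, right_ne_zero_of_mul hf0, ?_, hG', hR⟩⟩, ?_⟩
  · rw [hl2] at hG; exact hG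
  · simp [mulMap, hlc]

lemma coPairs_finite (F : Type) [Field F] [Fintype F] (a b : ℕ) : (coPairs F a b).Finite :=
  ((finite_hom F a).prod (finite_hom F b)).subset fun _ hp => ⟨hp.2.1, hp.2.2.1⟩

lemma count (F : Type) [Field F] [Fintype F] (a b : ℕ) (hab : a ≤ b) :
    ∑ k ∈ Finset.range (a + 1), (Fintype.card F ^ (k + 1) - 1) * (coPairs F (a - k) (b - k)).ncard
      = (Fintype.card F - 1) * ((Fintype.card F ^ (a + 1) - 1) * Fintype.card F ^ (b + 1)) := by
  have key := Nat.card_congr (Equiv.ofBijective _ ⟨mulMap_inj F a b hab, mulMap_surj F a b hab⟩)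
  have : ∀ n, Finite (nzForms F n) := fun n =>
    ((finite_hom F n).subset fun _ h => h.2).to_subtype
  have : ∀ n m, Finite (coPairs F n m) := fun n m => (coPairs_finite F n m).to_subtype
  rw [Nat.card_sigma] at key
  simp only [Nat.card_prod, Nat.card_coe_set_eq] at key
  have e : Nat.card {c : F // c ≠ 0} = Fintype.card F - 1 := by
    classical
    rw [Nat.card_eq_fintype_card, Fintype.card_subtype_compl]
    simp
  rw [e] at key
  simp only [nzForms, forms, ncard_hom, ncard_hom'] at key
  rw [← key, Finset.sum_range]

lemma countZ (F : Type) [Field F] [Fintype F] (a b : ℕ) (hab : a ≤ b) :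
    ∑ k ∈ Finset.range (a + 1), ((Fintype.card F : ℤ) ^ (k + 1) - 1) *
        ((coPairs F (a - k) (b - k)).ncard : ℤ)
      = (Fintype.card F - 1) * (((Fintype.card F : ℤ) ^ (a + 1) - 1) * Fintype.card F ^ (b + 1)) := by
  have h := count F a b hab
  have hp : ∀ n, 1 ≤ Fintype.card F ^ n := fun n => Nat.one_le_pow _ _ Fintype.card_pos
  zify [hp, Fintype.card_pos (α := F), Nat.one_le_iff_ne_zero] at h
  rw [← h]

lemma countZ' (F : Type) [Field F] [Fintype F] (a c : ℕ) :
    ∑ j ∈ Finset.range (a + 1), ((Fintype.card F : ℤ) ^ (a - j + 1) - 1) *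
        ((coPairs F j (j + c)).ncard : ℤ)
      = (Fintype.card F - 1) *
        (((Fintype.card F : ℤ) ^ (a + 1) - 1) * Fintype.card F ^ (a + c + 1)) := by
  rw [← countZ F a (a + c) (by omega), ← Finset.sum_range_reflect]
  refine Finset.sum_congr rfl fun j hj => ?_
  have := Finset.mem_range.mp hj
  have e1 : a + 1 - 1 - j = a - j := by omega
  have e2 : a - (a - j) = j := by omega
  have e3 : a - j + c = a + c - j := by omega
  rw [e1, e2, e3]

lemma cumul (F : Type) [Field F] [Fintype F] (a c : ℕ) :
    ∑ j ∈ Finset.range (a + 1), ((coPairs F j (j + c)).ncard : ℤ)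
      = (Fintype.card F - 1) * (Fintype.card F : ℤ) ^ (2 * a + c + 1) := by
  have hq : ((Fintype.card F : ℤ) - 1) ≠ 0 := by
    have := Fintype.one_lt_card (α := F)
    have : (1 : ℤ) < Fintype.card F := by exact_mod_cast this
    omega
  cases a with
  | zero =>
    have := countZ' F 0 c
    simp only [zero_add, Finset.sum_range_one, pow_one, Nat.sub_zero] at this ⊢
    have := mul_left_cancel₀ hq this
    rw [this]; ring_nf
  | succ a =>
    have h1 := countZ' F a c
    have h2 := countZ' F (a + 1) c
    have h3 : ∑ j ∈ Finset.range (a + 1 + 1), ((Fintype.card F : ℤ) ^ (a + 1 - j + 1) - 1) *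
        ((coPairs F j (j + c)).ncard : ℤ) =
        Fintype.card F * (∑ j ∈ Finset.range (a + 1), ((Fintype.card F : ℤ) ^ (a - j + 1) - 1) *
        ((coPairs F j (j + c)).ncard : ℤ)) + (Fintype.card F - 1) *
        ∑ j ∈ Finset.range (a + 1 + 1), ((coPairs F j (j + c)).ncard : ℤ) := by
      rw [Finset.sum_range_succ, Finset.sum_range_succ _ (a + 1), mul_add, ← add_assoc,
        Finset.mul_sum, Finset.mul_sum, ← Finset.sum_add_distrib]
      congr 1
      · refine Finset.sum_congr rfl fun j hj => ?_
        have := Finset.mem_range.mp hj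
        rw [show a + 1 - j + 1 = (a - j + 1) + 1 by omega, pow_succ]
        ring
      · simp
    rw [h1, h2] at h3
    apply mul_left_cancel₀ hq
    rw [eq_sub_of_add_eq' h3.symm]
    ring

lemma ncard_zero (F : Type) [Field F] [Fintype F] (c : ℕ) :
    ((coPairs F 0 c).ncard : ℤ) = (Fintype.card F - 1) * (Fintype.card F : ℤ) ^ (c + 1) := by
  have := cumul F 0 c
  simpa using this

lemma ncard_succ (F : Type) [Field F] [Fintype F] (a c : ℕ) :
    ((coPairs F (a + 1) (a + 1 + c)).ncard : ℤ) =
      (Fintype.card F - 1) * (Fintype.card F : ℤ) ^ (2 * a + c + 1) *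
        ((Fintype.card F : ℤ) ^ 2 - 1) := by
  have h1 := cumul F a c
  have h2 := cumul F (a + 1) c
  rw [Finset.sum_range_succ, h1] at h2
  rw [eq_sub_of_add_eq' h2]
  ring

lemma zero_case {F : Type} [Field F] {f : MvPolynomial (Fin 2) F} {m : ℕ} (hm : m ≠ 0)
    (hf : f.IsHomogeneous m) : ¬ IsRelPrime 0 f := by
  intro h
  have hu : IsUnit f := h (dvd_zero f) dvd_rfl
  obtain ⟨c, hc, rfl⟩ := isUnit_eq_C hu
  exact hm (hf.inj_right (isHomogeneous_C _ _) (by simpa using hc))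

/-- Finite-field point count of the space of relatively prime
pairs of binary forms of degrees `m₁ ≤ m₂`. -/
theorem stmt0 (F : Type) [Field F] [Fintype F] (q : ℕ) (hq : Fintype.card F = q)
    (m₁ m₂ : ℕ) (hm : m₁ ≤ m₂) :
    Nat.card {p : MvPolynomial (Fin 2) F × MvPolynomial (Fin 2) F //
        p.1.IsHomogeneous m₁ ∧ p.2.IsHomogeneous m₂ ∧ IsRelPrime p.1 p.2} =
      if m₁ = 0 ∧ m₂ = 0 then (q - 1) * (q + 1)
      else if m₁ = 0 then (q - 1) * q ^ (m₂ + 1)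
      else (q - 1) * q ^ (m₁ + m₂ - 1) * (q ^ 2 - 1) := by
  have hq1 : 1 ≤ q := hq ▸ Fintype.card_pos
  have hq2 : 1 ≤ q ^ 2 := Nat.one_le_pow _ _ hq1
  change Nat.card ({p | p.1.IsHomogeneous m₁ ∧ p.2.IsHomogeneous m₂ ∧ IsRelPrime p.1 p.2} :
    Set (MvPolynomial (Fin 2) F × MvPolynomial (Fin 2) F)) = _
  rw [Nat.card_coe_set_eq]
  by_cases h2 : m₂ = 0
  · have h1 : m₁ = 0 := by omega
    subst h1 h2
    have hset : ({p | p.1.IsHomogeneous 0 ∧ p.2.IsHomogeneous 0 ∧ IsRelPrime p.1 p.2} :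
        Set (MvPolynomial (Fin 2) F × MvPolynomial (Fin 2) F)) =
        coPairs F 0 0 ∪ (fun f => (0, f)) '' nzForms F 0 := by
      ext ⟨f, g⟩
      simp only [coPairs, nzForms, Set.mem_ofPred_eq, Set.mem_union, Set.mem_image, Prod.mk.injEq]
      constructor
      · rintro ⟨hf, hg, hr⟩
        by_cases hf0 : f = 0
        · right
          refine ⟨g, ⟨?_, hg⟩, hf0.symm, rfl⟩
          rintro rfl
          rw [hf0] at hr
          exact not_isUnit_zero (hr dvd_rfl dvd_rfl)
        · exact Or.inl ⟨hf0, hf, hg, hr⟩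
      · rintro (h | ⟨g', ⟨h0, hg⟩, rfl, rfl⟩)
        · exact h.2
        · refine ⟨isHomogeneous_zero _ _ _, hg, ?_⟩
          have hC := totalDegree_eq_zero_iff_eq_C.mp (Nat.le_zero.mp hg.totalDegree_le)
          have hu : IsUnit g' := by
            rw [hC]
            refine (IsUnit.mk0 _ ?_).map C
            intro h; rw [h] at hC; simp at hC; exact h0 hC
          exact hu.isRelPrime_right
    rw [hset, Set.ncard_union_eq ?_ (coPairs_finite F 0 0)
      (((finite_hom F 0).subset fun _ h => h.2).image _)]
    · rw [Set.ncard_image_of_injective _ (Prod.mk_right_injective 0)]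
      have h := ncard_zero F 0
      have h' := ncard_hom' F 0
      rw [hq] at h h'
      change (nzForms F 0).ncard = _ at h'
      rw [h', if_pos ⟨rfl, rfl⟩, zero_add, pow_one]
      zify [hq1]
      rw [h]
      ring
    · rw [Set.disjoint_left]
      rintro _ h ⟨g, hg, rfl⟩
      exact h.1 rfl
  · have hset : ({p | p.1.IsHomogeneous m₁ ∧ p.2.IsHomogeneous m₂ ∧ IsRelPrime p.1 p.2} :
        Set (MvPolynomial (Fin 2) F × MvPolynomial (Fin 2) F)) = coPairs F m₁ m₂ := by
      ext ⟨f, g⟩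
      simp only [coPairs, Set.mem_ofPred_eq]
      constructor
      · rintro ⟨hf, hg, hr⟩
        refine ⟨?_, hf, hg, hr⟩
        rintro rfl
        exact zero_case h2 hg hr
      · exact fun h => h.2
    rw [hset, if_neg (by tauto)]
    split_ifs with h1
    · subst h1
      have h := ncard_zero F m₂
      rw [hq] at h
      zify [hq1]
      rw [h]
    · obtain ⟨a, rfl⟩ := Nat.exists_eq_succ_of_ne_zero h1
      obtain ⟨c, rfl⟩ := Nat.exists_eq_add_of_le hm
      have h := ncard_succ F a c
      rw [hq] at h
      zify [hq1, hq2]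
      rw [Nat.succ_eq_add_one, h]
      congr 3
      omega
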